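/- There exist a constant C > 0, independent of μ and L, and a threshold L₀ ≥ R₀ depending only on v and R₀, with the following property. Suppose L ≥ L₀, 0 ≤ E ≤ 3 μ 𝔞₀^μ/(L − R₀)³, and f_L is the Neumann scattering function of a Neumann scattering solution with energy E. Then for all 0 < r ≤ L one has the uniform gradient bound |f_L'(r)| ≤ (C/(r² + R₀²)) · (𝔞₀^μ + ζ₀ (𝔠₀ − 𝔞₀^μ)/μ). -/

import Mathlib

open Set MeasureTheory

/-- A zero-energy scattering solution `m` for the radial potential `v` supported in `[0, R₀]`
with semiclassical parameter `μ`: it satisfies `μ m'' = v m` on `(0,∞)`, is continuous on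
`[0,∞)` and continuously differentiable on `(0,∞)`, with `m(0) = 0`, `m > 0` on `(0,∞)`, and
`m(r) = r - 𝔞₀^μ` for `r ≥ R₀`, where `𝔞₀^μ := R₀ - m(R₀)` is the scattering length. -/
structure ZeroEnergyScattering (v : ℝ → ℝ) (R₀ μ : ℝ) (m : ℝ → ℝ) : Prop where
  cont : ContinuousOn m (Set.Ici 0)
  diff : ∀ r ∈ Set.Ioi (0 : ℝ), DifferentiableAt ℝ m r
  derivCont : ContinuousOn (deriv m) (Set.Ioi 0)
  diff2 : ∀ r ∈ Set.Ioi (0 : ℝ), DifferentiableAt ℝ (deriv m) r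
  ode : ∀ r ∈ Set.Ioi (0 : ℝ), μ * deriv (deriv m) r = v r * m r
  zero : m 0 = 0
  pos : ∀ r ∈ Set.Ioi (0 : ℝ), 0 < m r
  radiation : ∀ r, R₀ ≤ r → m r = r - (R₀ - m R₀)

/-- A Neumann scattering solution `m₁` with energy `E` on `[0, L]`: it satisfies
`μ m₁'' = (v - E) m₁` on `(0,L)`, is continuous on `[0,L]` and continuously differentiable
on `(0,L]`, with `m₁(0) = 0`, `m₁ > 0` on `(0,L]`, `m₁(L) = L` and `m₁'(L) = 1`.  The Neumann
scattering function is `f_L(r) = m₁(r)/r`. -/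
structure NeumannScattering (v : ℝ → ℝ) (μ L E : ℝ) (m₁ : ℝ → ℝ) : Prop where
  cont : ContinuousOn m₁ (Set.Icc 0 L)
  diff : ∀ r ∈ Set.Ioc (0 : ℝ) L, DifferentiableAt ℝ m₁ r
  derivCont : ContinuousOn (deriv m₁) (Set.Ioc 0 L)
  diff2 : ∀ r ∈ Set.Ioo (0 : ℝ) L, DifferentiableAt ℝ (deriv m₁) r
  ode : ∀ r ∈ Set.Ioo (0 : ℝ) L, μ * deriv (deriv m₁) r = (v r - E) * m₁ r
  zero : m₁ 0 = 0
  pos : ∀ r ∈ Set.Ioc (0 : ℝ) L, 0 < m₁ r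
  bc : m₁ L = L
  bc' : deriv m₁ L = 1

/-- A function that is `O(r)` at the origin and has nonnegative derivative is nonnegative. -/
theorem nonneg_of_hasDerivAt_nonneg_of_abs_le {h h' : ℝ → ℝ} {b K : ℝ}
    (hc : ContinuousOn h (Ioc 0 b)) (hd : ∀ x ∈ Ioo 0 b, HasDerivAt h (h' x) x)
    (hn : ∀ x ∈ Ioo 0 b, 0 ≤ h' x) (hK : ∀ x ∈ Ioc 0 b, |h x| ≤ K * x) :
    ∀ x ∈ Ioc 0 b, 0 ≤ h x := by
  intro x hx
  have hmono : MonotoneOn h (Ioc 0 b) := by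
    refine monotoneOn_of_hasDerivWithinAt_nonneg (f' := h') (convex_Ioc 0 b) hc ?_ ?_
    · intro y hy
      rw [interior_Ioc] at hy
      exact (hd y hy).hasDerivWithinAt
    · intro y hy
      rw [interior_Ioc] at hy
      exact hn y hy
  have htend : Filter.Tendsto (fun y : ℝ => -(K * y)) (nhdsWithin 0 (Ioi 0)) (nhds 0) := by
    have : Continuous fun y : ℝ => -(K * y) := by fun_prop
    simpa using (this.tendsto 0).mono_left nhdsWithin_le_nhds
  refine le_of_tendsto htend ?_
  filter_upwards [Ioc_mem_nhdsGT hx.1] with y hy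
  have hy' : y ∈ Ioc 0 b := ⟨hy.1, hy.2.trans hx.2⟩
  linarith [neg_abs_le (h y), hK y hy', hmono hy' hx hy.2]

namespace ZeroEnergyScattering

variable {v m : ℝ → ℝ} {R₀ μ : ℝ}

theorem deriv_deriv_eq (hm : ZeroEnergyScattering v R₀ μ m) (hμ : 0 < μ) {r : ℝ} (hr : 0 < r) :
    deriv (deriv m) r = v r * m r / μ := by
  rw [eq_div_iff hμ.ne', mul_comm]
  exact hm.ode r hr

theorem deriv_monotoneOn (hm : ZeroEnergyScattering v R₀ μ m) (hμ : 0 < μ)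
    (hv : ∀ r, 0 ≤ v r) : MonotoneOn (deriv m) (Ioi 0) := by
  refine monotoneOn_of_deriv_nonneg (convex_Ioi 0) hm.derivCont ?_ ?_
  · rw [interior_Ioi]
    exact fun x hx => (hm.diff2 x hx).differentiableWithinAt
  · rw [interior_Ioi]
    intro x hx
    rw [hm.deriv_deriv_eq hμ hx]
    have := hm.pos x hx
    have := hv x
    positivity

theorem exists_eq_mul_deriv (hm : ZeroEnergyScattering v R₀ μ m) {r : ℝ} (hr : 0 < r) :
    ∃ ξ ∈ Ioo 0 r, m r = r * deriv m ξ := by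
  obtain ⟨ξ, hξ, h⟩ := exists_deriv_eq_slope m hr (hm.cont.mono Icc_subset_Ici_self)
    (fun x hx => (hm.diff x hx.1).differentiableWithinAt)
  refine ⟨ξ, hξ, ?_⟩
  rw [h, hm.zero, sub_zero, sub_zero]
  field_simp

theorem deriv_pos (hm : ZeroEnergyScattering v R₀ μ m) (hμ : 0 < μ)
    (hv : ∀ r, 0 ≤ v r) {r : ℝ} (hr : 0 < r) : 0 < deriv m r := by
  obtain ⟨ξ, hξ, h⟩ := hm.exists_eq_mul_deriv hr
  have h1 : 0 < r * deriv m ξ := h ▸ hm.pos r hr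
  exact (pos_of_mul_pos_right h1 hr.le).trans_le
    (hm.deriv_monotoneOn hμ hv hξ.1 hr hξ.2.le)

theorem deriv_le_one (hm : ZeroEnergyScattering v R₀ μ m) (hμ : 0 < μ)
    (hv : ∀ r, 0 ≤ v r) {r : ℝ} (hr : 0 < r) : deriv m r ≤ 1 := by
  have hs : R₀ < max r R₀ + 1 := (le_max_right r R₀).trans_lt (lt_add_one _)
  have hrs : r ≤ max r R₀ + 1 := (le_max_left r R₀).trans (lt_add_one _).le
  have heq : m =ᶠ[nhds (max r R₀ + 1)] fun s => s - (R₀ - m R₀) := by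
    filter_upwards [Ioi_mem_nhds hs] with s hs
    exact hm.radiation s (le_of_lt hs)
  have h1 : deriv m (max r R₀ + 1) = 1 := by
    rw [heq.deriv_eq]
    simp
  exact h1 ▸ hm.deriv_monotoneOn hμ hv hr (hr.trans_le hrs) hrs

theorem le_mul_deriv (hm : ZeroEnergyScattering v R₀ μ m) (hμ : 0 < μ)
    (hv : ∀ r, 0 ≤ v r) {r : ℝ} (hr : 0 < r) : m r ≤ r * deriv m r := by
  obtain ⟨ξ, hξ, h⟩ := hm.exists_eq_mul_deriv hr
  rw [h]
  exact mul_le_mul_of_nonneg_left (hm.deriv_monotoneOn hμ hv hξ.1 hr hξ.2.le) hr.le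

theorem le_self (hm : ZeroEnergyScattering v R₀ μ m) (hμ : 0 < μ)
    (hv : ∀ r, 0 ≤ v r) {r : ℝ} (hr : 0 < r) : m r ≤ r :=
  (hm.le_mul_deriv hμ hv hr).trans (by nlinarith [hm.deriv_le_one hμ hv hr])

theorem le_secant (hm : ZeroEnergyScattering v R₀ μ m) (hμ : 0 < μ)
    (hv : ∀ r, 0 ≤ v r) {s r : ℝ} (hs : 0 < s) (hsr : s ≤ r) : m s ≤ s * (m r / r) := by
  have hr : 0 < r := hs.trans_le hsr
  have hconv : ConvexOn ℝ (Ici 0) m := by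
    refine MonotoneOn.convexOn_of_deriv (convex_Ici 0) hm.cont ?_ ?_
    · rw [interior_Ici]
      exact fun x hx => (hm.diff x hx).differentiableWithinAt
    · rw [interior_Ici]
      exact hm.deriv_monotoneOn hμ hv
  have h := hconv.2 (self_mem_Ici (a := (0 : ℝ))) (show r ∈ Ici 0 from hr.le)
    (sub_nonneg.2 ((div_le_one hr).2 hsr)) (div_pos hs hr).le (sub_add_cancel _ _)
  simp only [smul_eq_mul, mul_zero, zero_add, hm.zero, div_mul_cancel₀ s hr.ne'] at h
  exact h.trans_eq (by ring)

/-- A zero-energy scattering solution grows at least linearly at the origin. -/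
theorem exists_mul_le (hm : ZeroEnergyScattering v R₀ μ m) (hμ : 0 < μ)
    (hv : ∀ r, 0 ≤ v r) {V : ℝ} (hV : ∀ r, v r ≤ V) :
    ∃ c > 0, ∀ r, 0 < r → c * r ≤ m r := by
  have hV0 : 0 ≤ V := (hv 0).trans (hV 0)
  obtain ⟨δ, hδ, hδV⟩ : ∃ δ > 0, δ ^ 2 * V / μ ≤ 1 / 2 := by
    have hden : 0 < μ + 2 * V := by positivity
    have h1 : μ / (μ + 2 * V) ≤ 1 := (div_le_one hden).2 (by linarith)
    have h0 : 0 < μ / (μ + 2 * V) := by positivity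
    refine ⟨μ / (μ + 2 * V), h0, ?_⟩
    rw [div_le_iff₀ hμ]
    have h2 : μ / (μ + 2 * V) * V ≤ μ / 2 := by
      rw [div_mul_eq_mul_div, div_le_iff₀ hden]
      nlinarith
    nlinarith [mul_nonneg h0.le hV0]
  have hdδ := hm.deriv_pos hμ hv hδ
  have hmono := hm.deriv_monotoneOn hμ hv
  have key : ∀ ξ, 0 < ξ → deriv m δ / 2 ≤ deriv m ξ := by
    intro ξ hξ
    rcases le_or_gt δ ξ with h | h
    · linarith [hmono hδ hξ h]
    · obtain ⟨η, hη, hs⟩ := exists_deriv_eq_slope (deriv m) h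
        (hm.derivCont.mono fun x hx => hξ.trans_le hx.1)
        (fun x hx => (hm.diff2 x (hξ.trans hx.1)).differentiableWithinAt)
      have hη0 : 0 < η := hξ.trans hη.1
      rw [hm.deriv_deriv_eq hμ hη0, eq_div_iff (sub_pos.2 h).ne'] at hs
      have h1 : m η ≤ δ * deriv m δ :=
        (hm.le_mul_deriv hμ hv hη0).trans
          (mul_le_mul hη.2.le (hmono hη0 hδ hη.2.le) (hm.deriv_pos hμ hv hη0).le hδ.le)
      have h2 : v η * m η / μ * (δ - ξ) ≤ V * (δ * deriv m δ) / μ * δ := by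
        have := hm.pos η hη0
        have := hv η
        gcongr
        · exact hV η
        · linarith
      have h3 : V * (δ * deriv m δ) / μ * δ = δ ^ 2 * V / μ * deriv m δ := by ring
      nlinarith
  refine ⟨deriv m δ / 2, by positivity, fun r hr => ?_⟩
  obtain ⟨ξ, hξ, h⟩ := hm.exists_eq_mul_deriv hr
  rw [h, mul_comm]
  exact mul_le_mul_of_nonneg_left (key ξ hξ.1) hr.le

end ZeroEnergyScattering

namespace NeumannScattering

variable {v m m₁ : ℝ → ℝ} {R₀ μ L E : ℝ}

theorem deriv_deriv_eq (h₁ : NeumannScattering v μ L E m₁) (hμ : 0 < μ) {r : ℝ}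
    (hr : r ∈ Ioo 0 L) : deriv (deriv m₁) r = (v r - E) / μ * m₁ r := by
  rw [div_mul_eq_mul_div, eq_div_iff hμ.ne', mul_comm]
  exact h₁.ode r hr

theorem exists_abs_deriv_le (h₁ : NeumannScattering v μ L E m₁) (hμ : 0 < μ) (hL : 0 < L)
    (hE : 0 ≤ E) (hv : ∀ r, 0 ≤ v r) {V : ℝ} (hV : ∀ r, v r ≤ V) :
    ∃ D, 0 ≤ D ∧ ∀ r ∈ Ioc 0 L, |deriv m₁ r| ≤ D := by
  have hV0 : 0 ≤ V := (hv 0).trans (hV 0)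
  obtain ⟨B, hB⟩ := isCompact_Icc.exists_bound_of_continuousOn h₁.cont
  have hB0 : 0 ≤ B := (norm_nonneg _).trans (hB L ⟨hL.le, le_rfl⟩)
  refine ⟨1 + (V + E) / μ * B * L, by positivity, fun r hr => ?_⟩
  rcases hr.2.eq_or_lt with rfl | hrL
  · rw [h₁.bc', abs_one, le_add_iff_nonneg_right]
    positivity
  obtain ⟨η, hη, hs⟩ := exists_deriv_eq_slope (deriv m₁) hrL
    (h₁.derivCont.mono fun x hx => ⟨hr.1.trans_le hx.1, hx.2⟩)
    (fun x hx => (h₁.diff2 x ⟨hr.1.trans hx.1, hx.2⟩).differentiableWithinAt)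
  have hη' : η ∈ Ioo 0 L := ⟨hr.1.trans hη.1, hη.2⟩
  rw [h₁.deriv_deriv_eq hμ hη', h₁.bc', eq_div_iff (sub_pos.2 hrL).ne'] at hs
  have h2 : |(v η - E) / μ * m₁ η * (L - r)| ≤ (V + E) / μ * B * L := by
    rw [abs_mul, abs_mul, abs_div, abs_of_pos hμ, abs_of_pos (sub_pos.2 hrL)]
    gcongr
    · rw [abs_le]
      constructor <;> linarith [hv η, hV η]
    · exact hB η ⟨hη'.1.le, hη'.2.le⟩
    · linarith [hr.1]
  rw [hs] at h2
  rw [abs_le] at h2 ⊢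
  constructor <;> linarith

theorem exists_eq_mul_deriv (h₁ : NeumannScattering v μ L E m₁) {r : ℝ} (hr : r ∈ Ioc 0 L) :
    ∃ ξ ∈ Ioo 0 r, m₁ r = r * deriv m₁ ξ := by
  obtain ⟨ξ, hξ, h⟩ := exists_deriv_eq_slope m₁ hr.1 (h₁.cont.mono (Icc_subset_Icc_right hr.2))
    (fun x hx => (h₁.diff x ⟨hx.1, hx.2.le.trans hr.2⟩).differentiableWithinAt)
  refine ⟨ξ, hξ, ?_⟩
  have := hr.1
  rw [h, h₁.zero, sub_zero, sub_zero]
  field_simp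

theorem le_mul_of_abs_deriv_le (h₁ : NeumannScattering v μ L E m₁) {D : ℝ}
    (hD : ∀ r ∈ Ioc 0 L, |deriv m₁ r| ≤ D) {r : ℝ} (hr : r ∈ Ioc 0 L) : m₁ r ≤ D * r := by
  obtain ⟨ξ, hξ, h⟩ := h₁.exists_eq_mul_deriv hr
  rw [h, mul_comm]
  exact mul_le_mul_of_nonneg_right
    ((le_abs_self _).trans (hD ξ ⟨hξ.1, hξ.2.le.trans hr.2⟩)) hr.1.le

/-- One step of the bootstrap for the ratio of the Neumann and the zero-energy solution,
based on the monotonicity of `r ↦ m₁ r / m r + E / μ * Q * r ^ 2 / 2`. -/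
theorem ratio_bootstrap (h₁ : NeumannScattering v μ L E m₁) (hm : ZeroEnergyScattering v R₀ μ m)
    (hμ : 0 < μ) (hL : 0 < L) (hE : 0 ≤ E) (hv : ∀ r, 0 ≤ v r) {V : ℝ} (hV : ∀ r, v r ≤ V)
    {Q : ℝ} (hQ0 : 0 ≤ Q) (hQ : ∀ r ∈ Ioc 0 L, m₁ r / m r ≤ Q) :
    ∀ r ∈ Ioc 0 L, m₁ r / m r ≤ L / m L + E / μ * L ^ 2 / 2 * Q := by
  obtain ⟨D, hD0, hD⟩ := h₁.exists_abs_deriv_le hμ hL hE hv hV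
  have hcm : ContinuousOn m (Ioc 0 L) := hm.cont.mono fun x hx => hx.1.le
  have hcm' : ContinuousOn (deriv m) (Ioc 0 L) := hm.derivCont.mono fun x hx => hx.1
  have hcm₁ : ContinuousOn m₁ (Ioc 0 L) := h₁.cont.mono Ioc_subset_Icc_self
  have hW : ∀ x ∈ Ioc 0 L, 0 ≤ deriv m₁ x * m x - m₁ x * deriv m x
      + E / μ * Q * (x * m x ^ 2) := by
    refine nonneg_of_hasDerivAt_nonneg_of_abs_le (K := 2 * D + E / μ * Q * L ^ 2)
      (h' := fun x => -(E / μ) * (m₁ x * m x) + E / μ * Q * (m x ^ 2 + x * (2 * m x * deriv m x)))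
      ?_ ?_ ?_ ?_
    · have := h₁.derivCont
      fun_prop
    · intro x hx
      have d1 := (h₁.diff x ⟨hx.1, hx.2.le⟩).hasDerivAt
      have d2 := (h₁.diff2 x hx).hasDerivAt
      have d3 := (hm.diff x hx.1).hasDerivAt
      have d4 := (hm.diff2 x hx.1).hasDerivAt
      rw [h₁.deriv_deriv_eq hμ hx] at d2
      rw [hm.deriv_deriv_eq hμ hx.1] at d4
      have := ((d2.mul d3).sub (d1.mul d4)).add
        (((hasDerivAt_id x).mul (d3.pow 2)).const_mul (E / μ * Q))
      refine this.congr_deriv ?_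
      simp
      ring
    · intro x hx
      have hmx := hm.pos x hx.1
      have hx' : x ∈ Ioc 0 L := ⟨hx.1, hx.2.le⟩
      have h1 : m₁ x * m x ≤ Q * m x ^ 2 := by
        have := (div_le_iff₀ hmx).1 (hQ x hx')
        nlinarith
      have h2 : 0 ≤ E / μ * (Q * m x ^ 2 - m₁ x * m x) :=
        mul_nonneg (by positivity) (sub_nonneg.2 h1)
      have h3 : 0 ≤ E / μ * Q * (x * (2 * m x * deriv m x)) := by
        have := hm.deriv_pos hμ hv hx.1
        have := hx.1
        positivity
      linarith
    · intro x hx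
      have hmx := hm.pos x hx.1
      have hmx' := hm.le_self hμ hv hx.1
      have hd0 := hm.deriv_pos hμ hv hx.1
      have hd1 := hm.deriv_le_one hμ hv hx.1
      have hm₁ := h₁.le_mul_of_abs_deriv_le hD hx
      have hm₁0 := h₁.pos x hx
      have hx0 := hx.1
      have b1 : |deriv m₁ x * m x| ≤ D * x := by
        rw [abs_mul, abs_of_pos hmx]
        have := hD x hx
        gcongr
      have b2 : |m₁ x * deriv m x| ≤ D * x := by
        rw [abs_of_pos (by positivity)]
        nlinarith
      have b3 : |E / μ * Q * (x * m x ^ 2)| ≤ E / μ * Q * L ^ 2 * x := by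
        rw [abs_of_nonneg (by positivity)]
        have : m x ≤ L := hmx'.trans hx.2
        have : x * m x ^ 2 ≤ L ^ 2 * x := by
          rw [mul_comm]
          gcongr
        rw [mul_assoc (E / μ * Q)]
        gcongr
      calc _ ≤ |deriv m₁ x * m x| + |m₁ x * deriv m x| + |E / μ * Q * (x * m x ^ 2)| :=
            (abs_add_le _ _).trans (add_le_add_left (abs_sub _ _) _)
        _ ≤ _ := by linarith
  have hmono : MonotoneOn (fun x => m₁ x / m x + E / μ * Q / 2 * x ^ 2) (Ioc 0 L) := by
    refine monotoneOn_of_hasDerivWithinAt_nonneg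
      (f' := fun x => (deriv m₁ x * m x - m₁ x * deriv m x) / m x ^ 2 + E / μ * Q / 2 * (2 * x))
      (convex_Ioc 0 L) ?_ ?_ ?_
    · exact (hcm₁.div hcm fun x hx => (hm.pos x hx.1).ne').add (by fun_prop)
    · rw [interior_Ioc]
      intro x hx
      have d1 := (h₁.diff x ⟨hx.1, hx.2.le⟩).hasDerivAt
      have d3 := (hm.diff x hx.1).hasDerivAt
      have := (d1.div d3 (hm.pos x hx.1).ne').add
        ((hasDerivAt_pow 2 x).const_mul (E / μ * Q / 2))
      exact (this.congr_deriv (by simp)).hasDerivWithinAt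
    · rw [interior_Ioc]
      intro x hx
      have hmx := hm.pos x hx.1
      have := hW x ⟨hx.1, hx.2.le⟩
      have h2 : (deriv m₁ x * m x - m₁ x * deriv m x) / m x ^ 2 + E / μ * Q / 2 * (2 * x)
          = (deriv m₁ x * m x - m₁ x * deriv m x + E / μ * Q * (x * m x ^ 2)) / m x ^ 2 := by
        field_simp
      rw [h2]
      positivity
  intro r hr
  have := hmono hr (show L ∈ Ioc 0 L from ⟨hL, le_rfl⟩) hr.2
  simp only [h₁.bc] at this
  have h0 : 0 ≤ E / μ * Q / 2 * r ^ 2 := by positivity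
  linarith

theorem le_mul_zeroEnergy (h₁ : NeumannScattering v μ L E m₁)
    (hm : ZeroEnergyScattering v R₀ μ m)
    (hμ : 0 < μ) (hL : 0 < L) (hE : 0 ≤ E) (hv : ∀ r, 0 ≤ v r) {V : ℝ} (hV : ∀ r, v r ≤ V)
    (hEL : E / μ * L ^ 2 ≤ 1) (hmL : L ≤ 2 * m L) :
    ∀ r ∈ Ioc 0 L, m₁ r ≤ 4 * m r := by
  obtain ⟨D, hD0, hD⟩ := h₁.exists_abs_deriv_le hμ hL hE hv hV
  obtain ⟨c, hc, hcm⟩ := hm.exists_mul_le hμ hv hV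
  set S := (fun r => m₁ r / m r) '' Ioc 0 L
  have hLm : L ∈ Ioc 0 L := ⟨hL, le_rfl⟩
  have hbdd : BddAbove S := by
    refine ⟨D / c, ?_⟩
    rintro _ ⟨r, hr, rfl⟩
    rw [div_le_div_iff₀ (hm.pos r hr.1) hc]
    have h1 := h₁.le_mul_of_abs_deriv_le hD hr
    have h2 := mul_le_mul_of_nonneg_left (hcm r hr.1) hD0
    have h3 := mul_le_mul_of_nonneg_right h1 hc.le
    linarith
  have hle : ∀ r ∈ Ioc 0 L, m₁ r / m r ≤ sSup S := fun r hr =>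
    le_csSup hbdd (mem_image_of_mem _ hr)
  have hS0 : 0 ≤ sSup S :=
    (div_pos (h₁.pos L hLm) (hm.pos L hL)).le.trans (hle L hLm)
  have hq : L / m L ≤ 2 := (div_le_iff₀ (hm.pos L hL)).2 hmL
  have hS : sSup S ≤ L / m L + E / μ * L ^ 2 / 2 * sSup S := by
    refine csSup_le ⟨_, mem_image_of_mem _ hLm⟩ ?_
    rintro _ ⟨r, hr, rfl⟩
    exact h₁.ratio_bootstrap hm hμ hL hE hv hV hS0 hle r hr
  have hS4 : sSup S ≤ 4 := by nlinarith
  intro r hr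
  exact (div_le_iff₀ (hm.pos r hr.1)).1 ((hle r hr).trans hS4)

theorem hasDerivAt_mul_deriv_sub (h₁ : NeumannScattering v μ L E m₁) (hμ : 0 < μ) {r : ℝ}
    (hr : r ∈ Ioo 0 L) :
    HasDerivAt (fun s => s * deriv m₁ s - m₁ s) (r * ((v r - E) / μ * m₁ r)) r := by
  have d1 := (h₁.diff r ⟨hr.1, hr.2.le⟩).hasDerivAt
  have d2 := (h₁.diff2 r hr).hasDerivAt
  rw [h₁.deriv_deriv_eq hμ hr] at d2
  exact (((hasDerivAt_id r).mul d2).sub d1).congr_deriv (by simp)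

theorem deriv_div_self (h₁ : NeumannScattering v μ L E m₁) {r : ℝ} (hr : r ∈ Ioc 0 L) :
    deriv (fun s => m₁ s / s) r = (r * deriv m₁ r - m₁ r) / r ^ 2 := by
  have := ((h₁.diff r hr).hasDerivAt.div (hasDerivAt_id r) hr.1.ne').deriv
  simp only [id, mul_one, mul_comm (deriv m₁ r)] at this
  exact this

/-- Bounds on `r² f_L'(r)` inside a ball on which `m₁` is at most `A r`. -/
theorem abs_mul_deriv_sub_bounds_of_le (h₁ : NeumannScattering v μ L E m₁) (hμ : 0 < μ)
    (hL : 0 < L) (hE : 0 ≤ E) (hv : ∀ r, 0 ≤ v r) {V : ℝ} (hV : ∀ r, v r ≤ V) {A b : ℝ}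
    (hbL : b ≤ L) (hA0 : 0 ≤ A) (hA : ∀ r ∈ Ioc 0 b, m₁ r ≤ A * r) :
    ∀ r ∈ Ioc 0 b, r * deriv m₁ r - m₁ r ≤ V / μ * A / 3 * r ^ 3 ∧
      -(E / μ * A / 3 * r ^ 3) ≤ r * deriv m₁ r - m₁ r := by
  have hV0 : 0 ≤ V := (hv 0).trans (hV 0)
  obtain ⟨D, hD0, hD⟩ := h₁.exists_abs_deriv_le hμ hL hE hv hV
  have hsub : Ioc 0 b ⊆ Ioc 0 L := Ioc_subset_Ioc_right hbL
  have hcm₁ : ContinuousOn m₁ (Ioc 0 b) :=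
    h₁.cont.mono (hsub.trans Ioc_subset_Icc_self)
  have hcd : ContinuousOn (deriv m₁) (Ioc 0 b) := h₁.derivCont.mono hsub
  have hg : ∀ x ∈ Ioc 0 b, |x * deriv m₁ x - m₁ x| ≤ 2 * D * x := by
    intro x hx
    have h1 := hD x (hsub hx)
    have h2 := h₁.le_mul_of_abs_deriv_le hD (hsub hx)
    have h3 := h₁.pos x (hsub hx)
    have h4 := hx.1
    rw [abs_le] at h1 ⊢
    constructor <;> nlinarith
  have hcube : ∀ {B : ℝ}, 0 ≤ B → ∀ x ∈ Ioc 0 b, |B / 3 * x ^ 3| ≤ B * b ^ 2 * x := by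
    intro B hB x hx
    have h4 := hx.1
    rw [abs_of_nonneg (by positivity)]
    have : x ^ 2 ≤ b ^ 2 := by gcongr; exact hx.2
    have h5 : 0 ≤ B * x * (b ^ 2 - x ^ 2) := mul_nonneg (by positivity) (sub_nonneg.2 this)
    have h6 : 0 ≤ B * x * x ^ 2 := by positivity
    nlinarith
  have hderiv : ∀ (B x : ℝ), HasDerivAt (fun s => B / 3 * s ^ 3) (B * x ^ 2) x := fun B x =>
    ((hasDerivAt_pow 3 x).const_mul (B / 3)).congr_deriv (by norm_num; ring)
  have hIoo : ∀ x ∈ Ioo 0 b, x ∈ Ioo 0 L := fun x hx => ⟨hx.1, hx.2.trans_le hbL⟩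
  have hm2 : ∀ x ∈ Ioo 0 b, 0 ≤ x * m₁ x ∧ x * m₁ x ≤ A * x ^ 2 := by
    intro x hx
    have h1 := hA x ⟨hx.1, hx.2.le⟩
    have h2 := h₁.pos x ⟨hx.1, (hIoo x hx).2.le⟩
    have h3 := hx.1
    constructor
    · positivity
    · nlinarith
  intro r hr
  constructor
  · rw [← sub_nonneg]
    have hB : 0 ≤ V / μ * A := by positivity
    refine nonneg_of_hasDerivAt_nonneg_of_abs_le (b := b)
      (h := fun r => V / μ * A / 3 * r ^ 3 - (r * deriv m₁ r - m₁ r))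
      (K := V / μ * A * b ^ 2 + 2 * D) (by fun_prop)
      (fun x hx => (hderiv _ x).sub (h₁.hasDerivAt_mul_deriv_sub hμ (hIoo x hx))) ?_ ?_ r hr
    · intro x hx
      obtain ⟨h1, h2⟩ := hm2 x hx
      have h3 : (v x - E) / μ ≤ V / μ := by gcongr; linarith [hV x]
      have h4 := mul_le_mul_of_nonneg_right h3 h1
      have h5 := mul_le_mul_of_nonneg_left h2 (show 0 ≤ V / μ by positivity)
      linarith
    · intro x hx
      refine (abs_sub _ _).trans ?_
      linarith [hg x hx, hcube hB x hx]
  · rw [← sub_nonneg]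
    have hB : 0 ≤ E / μ * A := by positivity
    refine nonneg_of_hasDerivAt_nonneg_of_abs_le (b := b)
      (h := fun r => r * deriv m₁ r - m₁ r - -(E / μ * A / 3 * r ^ 3))
      (K := E / μ * A * b ^ 2 + 2 * D) (by fun_prop)
      (fun x hx => (h₁.hasDerivAt_mul_deriv_sub hμ (hIoo x hx)).sub (hderiv _ x).neg) ?_ ?_ r hr
    · intro x hx
      obtain ⟨h1, h2⟩ := hm2 x hx
      have h3 : -(E / μ) ≤ (v x - E) / μ := by
        rw [← neg_div]
        gcongr
        linarith [hv x]
      have h4 := mul_le_mul_of_nonneg_right h3 h1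
      have h5 := mul_le_mul_of_nonneg_left h2 (show 0 ≤ E / μ by positivity)
      linarith
    · intro x hx
      refine (abs_sub _ _).trans ?_
      rw [abs_neg]
      linarith [hg x hx, hcube hB x hx]

/-- Bounds on `r² f_L'(r)` outside the support of the potential. -/
theorem mul_deriv_sub_bounds_outside (h₁ : NeumannScattering v μ L E m₁) (hμ : 0 < μ)
    (hR₀ : 0 < R₀) (hE : 0 ≤ E) (hsupp : ∀ r, R₀ ≤ r → v r = 0) {A : ℝ}
    (hA : ∀ r ∈ Ioc 0 L, m₁ r ≤ A * r) {r : ℝ} (hr : R₀ ≤ r) (hrL : r ≤ L) :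
    0 ≤ r * deriv m₁ r - m₁ r ∧
      r * deriv m₁ r - m₁ r ≤ E / μ * A / 3 * (L ^ 3 - r ^ 3) := by
  have hsub : Icc R₀ L ⊆ Ioc 0 L := fun x hx => ⟨hR₀.trans_le hx.1, hx.2⟩
  have hcm₁ : ContinuousOn m₁ (Icc R₀ L) := h₁.cont.mono (hsub.trans Ioc_subset_Icc_self)
  have hcd : ContinuousOn (deriv m₁) (Icc R₀ L) := h₁.derivCont.mono hsub
  have hd : ∀ x ∈ Ioo R₀ L, HasDerivAt (fun s => s * deriv m₁ s - m₁ s)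
      (-(E / μ * (x * m₁ x))) x := fun x hx =>
    (h₁.hasDerivAt_mul_deriv_sub hμ ⟨hR₀.trans hx.1, hx.2⟩).congr_deriv
      (by rw [hsupp x hx.1.le]; ring)
  have hLmem : L ∈ Icc R₀ L := ⟨hr.trans hrL, le_rfl⟩
  have hL0 : L * deriv m₁ L - m₁ L = 0 := by rw [h₁.bc, h₁.bc']; ring
  constructor
  · have hanti : AntitoneOn (fun s => s * deriv m₁ s - m₁ s) (Icc R₀ L) := by
      refine antitoneOn_of_hasDerivWithinAt_nonpos (f' := fun x => -(E / μ * (x * m₁ x)))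
        (convex_Icc R₀ L) (by fun_prop) ?_ ?_
      · rw [interior_Icc]
        exact fun x hx => (hd x hx).hasDerivWithinAt
      · rw [interior_Icc]
        intro x hx
        have h1 := hR₀.trans hx.1
        have h2 := h₁.pos x ⟨h1, hx.2.le⟩
        rw [neg_nonpos]
        positivity
    exact hL0 ▸ hanti ⟨hr, hrL⟩ hLmem hrL
  · have hmono : MonotoneOn (fun s => s * deriv m₁ s - m₁ s + E / μ * A / 3 * s ^ 3)
        (Icc R₀ L) := by
      refine monotoneOn_of_hasDerivWithinAt_nonneg
        (f' := fun x => -(E / μ * (x * m₁ x)) + E / μ * A * x ^ 2)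
        (convex_Icc R₀ L) (by fun_prop) ?_ ?_
      · rw [interior_Icc]
        intro x hx
        exact ((hd x hx).add (((hasDerivAt_pow 3 x).const_mul (E / μ * A / 3)).congr_deriv
          (by norm_num; ring))).hasDerivWithinAt
      · rw [interior_Icc]
        intro x hx
        have h1 := hR₀.trans hx.1
        have h2 := hA x ⟨h1, hx.2.le⟩
        have h3 : 0 ≤ E / μ * x * (A * x - m₁ x) := mul_nonneg (by positivity) (sub_nonneg.2 h2)
        linarith
    have := hmono ⟨hr, hrL⟩ hLmem hrL
    simp only [hL0] at this
    linarith

end NeumannScattering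

/-- **Uniform gradient bound for the Neumann scattering function.**  There exist a constant
`C > 0`, independent of `μ` and `L`, and a threshold `L₀ ≥ R₀` depending only on `v` and
`R₀`, such that whenever `L ≥ L₀`, `0 ≤ E ≤ 3μ𝔞₀^μ/(L-R₀)³` and `f_L = m₁/r` is the Neumann
scattering function of a Neumann scattering solution with energy `E`, one has
`|f_L'(r)| ≤ C/(r²+R₀²) · (𝔞₀^μ + ζ₀(𝔠₀-𝔞₀^μ)/μ)` for all `0 < r ≤ L`,
where `𝔠₀ = R₀` and `ζ₀ = R₀² ⨆ᵣ v(r)`. -/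
theorem neumann_scattering_uniform_gradient_bound
    (R₀ : ℝ) (hR₀ : 0 < R₀)
    (v : ℝ → ℝ) (hv_meas : Measurable v) (hv_nonneg : ∀ r, 0 ≤ v r)
    (hv_bdd : BddAbove (Set.range v))
    (hv_supp : ∀ r, R₀ ≤ r → v r = 0) :
    ∃ C > (0 : ℝ), ∃ L₀ ≥ R₀,
      ∀ μ : ℝ, 0 < μ →
      ∀ m : ℝ → ℝ, ZeroEnergyScattering v R₀ μ m →
      ∀ L E : ℝ, L₀ ≤ L → 0 ≤ E → E ≤ 3 * μ * (R₀ - m R₀) / (L - R₀) ^ 3 →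
      ∀ m₁ : ℝ → ℝ, NeumannScattering v μ L E m₁ →
      ∀ r, 0 < r → r ≤ L →
        |deriv (fun s => m₁ s / s) r| ≤
          C / (r ^ 2 + R₀ ^ 2) *
            ((R₀ - m R₀) + R₀ ^ 2 * (⨆ r', v r') * (R₀ - (R₀ - m R₀)) / μ) := by
  set V := ⨆ r', v r'
  have hV : ∀ r, v r ≤ V := le_ciSup hv_bdd
  have hV0 : 0 ≤ V := (hv_nonneg 0).trans (hV 0)
  refine ⟨24, by norm_num, 10 * R₀, by linarith, ?_⟩
  intro μ hμ m hm L E hL hE hE' m₁ h₁ r hr hrL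
  have hL0 : 0 < L := by linarith
  have hmR := hm.pos R₀ hR₀
  have hmR' := hm.le_self hμ hv_nonneg hR₀
  set a := R₀ - m R₀ with ha
  have ha0 : 0 ≤ a := by linarith
  have haR : a ≤ R₀ := by linarith
  have hmL : L ≤ 2 * m L := by
    rw [hm.radiation L (by linarith), ← ha]
    linarith
  have he : E / μ * (L - R₀) ^ 3 ≤ 3 * a := by
    rw [le_div_iff₀ (pow_pos (by linarith) 3)] at hE'
    rw [div_mul_eq_mul_div, div_le_iff₀ hμ]
    linarith
  have he0 : 0 ≤ E / μ := by positivity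
  have hpow : L ^ 3 ≤ 2 * (L - R₀) ^ 3 := by
    have h1 : (9 / 10 * L) ^ 3 ≤ (L - R₀) ^ 3 := by
      gcongr
      linarith
    have h2 : 0 < L ^ 3 := by positivity
    linarith
  have heL : E / μ * L ^ 3 ≤ 6 * a := by
    linarith [mul_le_mul_of_nonneg_left hpow he0]
  have hEL : E / μ * L ^ 2 ≤ 1 := by
    have h1 : E / μ * L ^ 2 * L ≤ 1 * L := by linarith
    exact le_of_mul_le_mul_right h1 hL0
  have hcmp := h₁.le_mul_zeroEnergy hm hμ hL0 hE hv_nonneg hV hEL hmL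
  have hrm : r ∈ Ioc 0 L := ⟨hr, hrL⟩
  rw [h₁.deriv_div_self hrm, abs_div, abs_of_pos (pow_pos hr 2), show R₀ - a = m R₀ by linarith]
  have hZ : 0 ≤ R₀ ^ 2 * V * m R₀ / μ := by positivity
  have hsum : 0 < r ^ 2 + R₀ ^ 2 := by positivity
  rw [div_mul_eq_mul_div, div_le_div_iff₀ (pow_pos hr 2) hsum]
  rcases le_or_gt R₀ r with h | h
  · obtain ⟨g1, g2⟩ := h₁.mul_deriv_sub_bounds_outside hμ hR₀ hE hv_supp (A := 4)
      (fun x hx => (hcmp x hx).trans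
        (by linarith [hm.le_self hμ hv_nonneg hx.1])) h hrL
    rw [abs_of_nonneg g1]
    have h3 : r * deriv m₁ r - m₁ r ≤ 8 * a := by
      have : 0 ≤ E / μ * r ^ 3 := by positivity
      linarith
    have h4 : r ^ 2 + R₀ ^ 2 ≤ 2 * r ^ 2 := by
      linarith [pow_le_pow_left₀ hR₀.le h 2]
    calc _ ≤ 8 * a * (2 * r ^ 2) := by gcongr
      _ ≤ _ := by linarith [mul_nonneg ha0 (sq_nonneg r), mul_nonneg hZ (sq_nonneg r)]
  · have hbL : R₀ ≤ L := by linarith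
    have hin : r ∈ Ioc 0 R₀ := ⟨hr, h.le⟩
    have g1 := (h₁.abs_mul_deriv_sub_bounds_of_le hμ hL0 hE hv_nonneg hV hbL
      (A := 4 * (m R₀ / R₀)) (by positivity) (fun x hx =>
        (hcmp x ⟨hx.1, hx.2.trans hbL⟩).trans
          (by linarith [hm.le_secant hμ hv_nonneg hx.1 hx.2])) r hin).1
    have g2 := (h₁.abs_mul_deriv_sub_bounds_of_le hμ hL0 hE hv_nonneg hV hbL
      (A := 4) (by norm_num) (fun x hx =>
        (hcmp x ⟨hx.1, hx.2.trans hbL⟩).trans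
          (by linarith [hm.le_self hμ hv_nonneg hx.1])) r hin).2
    have h4 : r ^ 2 + R₀ ^ 2 ≤ 2 * R₀ ^ 2 := by
      linarith [pow_le_pow_left₀ hr.le h.le 2]
    have hr3 : r ^ 3 ≤ R₀ * r ^ 2 := by
      linarith [mul_le_mul_of_nonneg_right h.le (sq_nonneg r)]
    have hup : V / μ * (4 * (m R₀ / R₀)) / 3 * r ^ 3 ≤ 2 * (V * m R₀ / μ) * r ^ 2 := by
      calc _ ≤ V / μ * (4 * (m R₀ / R₀)) / 3 * (R₀ * r ^ 2) := by gcongr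
        _ = 4 / 3 * (V * m R₀ / μ) * r ^ 2 := by field_simp
        _ ≤ _ := by gcongr; norm_num
    have heR : E / μ * R₀ ^ 3 ≤ a := by
      have h5 : (9 * R₀) ^ 3 ≤ (L - R₀) ^ 3 := by gcongr; linarith
      have h6 : 0 ≤ E / μ * R₀ ^ 3 := by positivity
      linarith [mul_le_mul_of_nonneg_left h5 he0]
    have hlow : E / μ * 4 / 3 * r ^ 3 * R₀ ^ 2 ≤ 2 * a * r ^ 2 := by
      calc _ ≤ E / μ * 4 / 3 * (R₀ * r ^ 2) * R₀ ^ 2 := by gcongr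
        _ = 4 / 3 * (E / μ * R₀ ^ 3) * r ^ 2 := by ring
        _ ≤ 2 * a * r ^ 2 := by gcongr; norm_num
    have habs : |r * deriv m₁ r - m₁ r| * R₀ ^ 2 ≤ 2 * (a + R₀ ^ 2 * V * m R₀ / μ) * r ^ 2 := by
      have e1 : R₀ ^ 2 * V * m R₀ / μ = V * m R₀ / μ * R₀ ^ 2 := by ring
      have hZr := mul_nonneg hZ (sq_nonneg r)
      have har := mul_nonneg ha0 (sq_nonneg r)
      rw [← abs_of_pos (pow_pos hR₀ 2), ← abs_mul, abs_of_pos (pow_pos hR₀ 2), abs_le]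
      have k1 := mul_le_mul_of_nonneg_right (g1.trans hup) (sq_nonneg R₀)
      have k2 := mul_le_mul_of_nonneg_right g2 (sq_nonneg R₀)
      rw [e1] at hZr ⊢
      constructor <;> linarith
    calc _ ≤ |r * deriv m₁ r - m₁ r| * (2 * R₀ ^ 2) := by gcongr
      _ = 2 * (|r * deriv m₁ r - m₁ r| * R₀ ^ 2) := by ring
      _ ≤ 2 * (2 * (a + R₀ ^ 2 * V * m R₀ / μ) * r ^ 2) := by gcongr
      _ ≤ _ := by linarith [mul_nonneg (add_nonneg ha0 hZ) (sq_nonneg r)]
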